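/- For every η > 0 there exists a constant C depending only on η such that for every three times continuously differentiable compactly supported g : ℝ³ → ℝ³, ∫_{ℝ³} |∇²g|³ dx ≤ η ∫_{ℝ³} |∇³g|² dx + C ∫_{ℝ³} |∇g|² |∇²g|² dx. -/

import Mathlib

open MeasureTheory

noncomputable section

/-- Euclidean three-space. -/
abbrev E3 := EuclideanSpace ℝ (Fin 3)

/-- The j-th partial derivative of a scalar function on ℝ³. -/
def pder (j : Fin 3) (f : E3 → ℝ) : E3 → ℝ :=
  fun x => fderiv ℝ f x (EuclideanSpace.single j 1)

/-- |∇v|², the squared Euclidean norm of the gradient of v : ℝ³ → ℝ³. -/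
def grad2 (v : E3 → E3) (x : E3) : ℝ :=
  ∑ i : Fin 3, ∑ j : Fin 3, (pder j (fun y => v y i) x) ^ 2

/-- |∇²v|², the squared norm of the second derivatives of v : ℝ³ → ℝ³. -/
def hess2 (v : E3 → E3) (x : E3) : ℝ :=
  ∑ i : Fin 3, ∑ j : Fin 3, ∑ k : Fin 3, (pder k (pder j (fun y => v y i)) x) ^ 2

/-- |∇³v|², the squared norm of the third derivatives of v : ℝ³ → ℝ³. -/
def third2 (v : E3 → E3) (x : E3) : ℝ :=
  ∑ i : Fin 3, ∑ j : Fin 3, ∑ k : Fin 3, ∑ l : Fin 3,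
    (pder l (pder k (pder j (fun y => v y i))) x) ^ 2

lemma hasDerivAt_mul_abs (t : ℝ) : HasDerivAt (fun s : ℝ => s * |s|) (2 * |t|) t := by
  have key : ∀ y : ℝ, y ≠ 0 → HasDerivAt (fun s : ℝ => s * |s|) (2 * |y|) y := by
    intro y hy
    have h := (hasDerivAt_id y).mul (hasDerivAt_abs hy)
    have e : (1 : ℝ) * |y| + id y * (SignType.sign y : ℝ) = 2 * |y| := by
      have := self_mul_sign y
      simp only [id]
      linarith
    rw [e] at h
    exact h
  by_cases ht : t = 0
  · subst ht
    refine hasDerivAt_of_hasDerivAt_of_ne (g := fun y : ℝ => 2 * |y|) (fun y hy => key y hy) ?_ ?_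
    · fun_prop
    · fun_prop
  · exact key t ht

lemma pder_contDiff {m n : WithTop ℕ∞} (j : Fin 3) {f : E3 → ℝ} (hf : ContDiff ℝ n f)
    (h : m + 1 ≤ n) : ContDiff ℝ m (pder j f) :=
  (hf.fderiv_right h).clm_apply contDiff_const

lemma pder_supp (j : Fin 3) {f : E3 → ℝ} (hf : HasCompactSupport f) :
    HasCompactSupport (pder j f) := hf.fderiv_apply (𝕜 := ℝ) _

lemma scalar_bound (k : Fin 3) (b : E3 → ℝ) (hb : ContDiff ℝ 2 b) (hs : HasCompactSupport b)
    (δ : ℝ) (hδ : 0 < δ) :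
    ∫ x, |pder k b x| ^ 3 ≤
      ∫ x, (δ * (pder k (pder k b) x) ^ 2 + δ⁻¹ * ((b x) ^ 2 * (pder k b x) ^ 2)) := by
  have ha : ContDiff ℝ 1 (pder k b) := pder_contDiff k hb (by norm_num)
  have hac := ha.continuous
  have hbc := hb.continuous
  have hsa := pder_supp k hs
  have hcc : Continuous (pder k (pder k b)) :=
    (pder_contDiff (m := 0) k ha (by norm_num)).continuous
  have hsc := pder_supp k hsa
  have hF : ∀ x, HasFDerivAt (fun x => pder k b x * |pder k b x|)
      ((2 * |pder k b x|) • fderiv ℝ (pder k b) x) x := fun x =>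
    (hasDerivAt_mul_abs (pder k b x)).comp_hasFDerivAt x
      ((ha.differentiable (by norm_num)) x).hasFDerivAt
  have hF' : ∀ x, fderiv ℝ (fun x => pder k b x * |pder k b x|) x (EuclideanSpace.single k 1)
      = 2 * |pder k b x| * pder k (pder k b) x := by
    intro x
    rw [(hF x).fderiv]
    simp [pder]
  have ibp := integral_mul_fderiv_eq_neg_fderiv_mul_of_integrable (μ := (volume : Measure E3))
    (f := fun x => pder k b x * |pder k b x|) (g := b) (v := EuclideanSpace.single k 1)
    (by
      simp only [hF']
      exact Continuous.integrable_of_hasCompactSupport (by fun_prop) (hs.mul_left))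
    (by
      change Integrable (fun x => pder k b x * |pder k b x| * pder k b x) volume
      exact Continuous.integrable_of_hasCompactSupport (by fun_prop) (hsa.mul_left))
    (Continuous.integrable_of_hasCompactSupport (by fun_prop) (hs.mul_left))
    (fun x _ => (hF x).differentiableAt) (fun x _ => hb.differentiable (by norm_num) x)
  simp only [hF'] at ibp
  rw [← integral_neg] at ibp
  have e : ∀ x, |pder k b x| ^ 3 = pder k b x * |pder k b x| *
      fderiv ℝ b x (EuclideanSpace.single k 1) := by
    intro x
    change _ = pder k b x * |pder k b x| * pder k b x
    have := abs_mul_abs_self (pder k b x)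
    linear_combination |pder k b x| * this
  simp only [e]
  rw [ibp]
  apply integral_mono
  · exact Continuous.integrable_of_hasCompactSupport (by fun_prop) (hs.mul_left.neg)
  · refine Continuous.integrable_of_hasCompactSupport (by fun_prop) (HasCompactSupport.add ?_ ?_)
    · refine HasCompactSupport.mul_left ?_
      simp only [pow_two]
      exact hsc.mul_left
    · refine HasCompactSupport.mul_left (HasCompactSupport.mul_left ?_)
      simp only [pow_two]
      exact hsa.mul_left
  · intro x
    simp only
    set c := pder k (pder k b) x
    set a := pder k b x
    have h1 : 0 ≤ δ⁻¹ * (δ * c + |a| * b x) ^ 2 := by positivity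
    have h2 : δ⁻¹ * (δ * c + |a| * b x) ^ 2
        = δ * c ^ 2 + 2 * |a| * c * b x + δ⁻¹ * (b x ^ 2 * |a| ^ 2) := by
      field_simp
      ring
    rw [h2, sq_abs] at h1
    linarith

lemma sqrt_cube_le (a : Fin 3 → Fin 3 → Fin 3 → ℝ) :
    Real.sqrt (∑ i, ∑ j, ∑ k, a i j k ^ 2) ^ 3 ≤ 729 * ∑ i, ∑ j, ∑ k, |a i j k| ^ 3 := by
  have h0 : ∀ f : Fin 3 → Fin 3 → Fin 3 → ℝ, ∑ i, ∑ j, ∑ k, f i j k =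
      ∑ p : Fin 3 × Fin 3 × Fin 3, f p.1 p.2.1 p.2.2 := by
    intro f
    simp only [Fintype.sum_prod_type]
  rw [h0, h0]
  have h1 : Real.sqrt (∑ p : Fin 3 × Fin 3 × Fin 3, a p.1 p.2.1 p.2.2 ^ 2) ≤
      ∑ p : Fin 3 × Fin 3 × Fin 3, |a p.1 p.2.1 p.2.2| := by
    apply Real.sqrt_le_iff.2
    refine ⟨Finset.sum_nonneg fun _ _ => abs_nonneg _, ?_⟩
    have := Finset.sum_sq_le_sq_sum_of_nonneg (s := Finset.univ)
      (f := fun p : Fin 3 × Fin 3 × Fin 3 => |a p.1 p.2.1 p.2.2|) (fun _ _ => abs_nonneg _)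
    simpa only [sq_abs] using this
  have h2 := pow_sum_div_card_le_sum_pow (s := Finset.univ)
      (f := fun p : Fin 3 × Fin 3 × Fin 3 => |a p.1 p.2.1 p.2.2|) (fun _ _ => abs_nonneg _) 2
  have hc : (Finset.univ : Finset (Fin 3 × Fin 3 × Fin 3)).card = 27 := by simp
  rw [hc, div_le_iff₀ (by norm_num)] at h2
  refine (pow_le_pow_left₀ (Real.sqrt_nonneg _) h1 3).trans (h2.trans (le_of_eq ?_))
  norm_num
  ring

lemma supp_sum {f : Fin 3 → E3 → ℝ} (h : ∀ i, HasCompactSupport (f i)) :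
    HasCompactSupport (fun x => ∑ i, f i x) := by
  simp only [Fin.sum_univ_three]
  exact ((h 0).add (h 1)).add (h 2)

lemma supp_sq {f : E3 → ℝ} (h : HasCompactSupport f) :
    HasCompactSupport (fun x => f x ^ 2) := by
  simp only [pow_two]
  exact h.mul_left

/-- inequality (2.13): for every η > 0 there is a constant C depending
only on η such that for every C³ compactly supported g : ℝ³ → ℝ³,
∫ |∇²g|³ ≤ η ∫ |∇³g|² + C ∫ |∇g|² |∇²g|². -/
theorem hess_cubed_bound :
    ∀ η : ℝ, 0 < η → ∃ C : ℝ, ∀ g : E3 → E3, ContDiff ℝ 3 g → HasCompactSupport g →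
      ∫ x, Real.sqrt (hess2 g x) ^ 3 ≤
        η * (∫ x, third2 g x) + C * ∫ x, grad2 g x * hess2 g x := by
  intro η hη
  set δ : ℝ := η / 19683 with hδd
  have hδ : 0 < δ := by positivity
  refine ⟨19683 * δ⁻¹, fun g hg hgs => ?_⟩
  have c0 : ∀ i, ContDiff ℝ 3 (fun y => g y i) := fun i => by fun_prop
  have s0 : ∀ i, HasCompactSupport (fun y => g y i) := fun i =>
    hgs.comp_left (g := fun v : E3 => v i) rfl
  have c1 : ∀ i j, ContDiff ℝ 2 (pder j (fun y => g y i)) := fun i j =>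
    pder_contDiff j (c0 i) (by norm_num)
  have s1 : ∀ i j, HasCompactSupport (pder j (fun y => g y i)) := fun i j => pder_supp j (s0 i)
  have c2 : ∀ i j k, ContDiff ℝ 1 (pder k (pder j (fun y => g y i))) := fun i j k =>
    pder_contDiff k (c1 i j) (by norm_num)
  have s2 : ∀ i j k, HasCompactSupport (pder k (pder j (fun y => g y i))) :=
    fun i j k => pder_supp k (s1 i j)
  have c3 : ∀ i j k l, Continuous (pder l (pder k (pder j (fun y => g y i)))) := fun i j k l =>
    (pder_contDiff (m := 0) l (c2 i j k) (by norm_num)).continuous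
  have s3 : ∀ i j k l, HasCompactSupport (pder l (pder k (pder j (fun y => g y i)))) :=
    fun i j k l => pder_supp l (s2 i j k)
  have c1' := fun i j => (c1 i j).continuous
  have c2' := fun i j k => (c2 i j k).continuous
  have hG : Continuous (grad2 g) := by unfold grad2; fun_prop
  have hH : Continuous (hess2 g) := by unfold hess2; fun_prop
  have hT : Continuous (third2 g) := by unfold third2; fun_prop
  have sH : HasCompactSupport (hess2 g) := by
    unfold hess2
    exact supp_sum fun i => supp_sum fun j => supp_sum fun k => supp_sq (s2 i j k)
  have sT : HasCompactSupport (third2 g) := by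
    unfold third2
    exact supp_sum fun i => supp_sum fun j => supp_sum fun k => supp_sum fun l =>
      supp_sq (s3 i j k l)
  have iT : Integrable (third2 g) := hT.integrable_of_hasCompactSupport sT
  have iGH : Integrable (fun x => grad2 g x * hess2 g x) :=
    (hG.mul hH).integrable_of_hasCompactSupport sH.mul_left
  have i3 : ∀ i j k, Integrable (fun x => |pder k (pder j (fun y => g y i)) x| ^ 3) := by
    intro i j k
    refine Continuous.integrable_of_hasCompactSupport (by have := c2' i j k; fun_prop) ?_
    exact (s2 i j k).comp_left (g := fun t : ℝ => |t| ^ 3) (by simp)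
  have bT : ∀ i j k x, (pder k (pder k (pder j (fun y => g y i))) x) ^ 2 ≤ third2 g x := by
    intro i j k x
    unfold third2
    refine le_trans ?_ (Finset.single_le_sum (fun _ _ => by positivity) (Finset.mem_univ i))
    refine le_trans ?_ (Finset.single_le_sum (fun _ _ => by positivity) (Finset.mem_univ j))
    refine le_trans ?_ (Finset.single_le_sum (fun _ _ => by positivity) (Finset.mem_univ k))
    exact Finset.single_le_sum
      (f := fun l => (pder l (pder k (pder j (fun y => g y i))) x) ^ 2)
      (fun _ _ => by positivity) (Finset.mem_univ k)
  have bH : ∀ i j k x, (pder k (pder j (fun y => g y i)) x) ^ 2 ≤ hess2 g x := by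
    intro i j k x
    unfold hess2
    refine le_trans ?_ (Finset.single_le_sum (fun _ _ => by positivity) (Finset.mem_univ i))
    refine le_trans ?_ (Finset.single_le_sum (fun _ _ => by positivity) (Finset.mem_univ j))
    exact Finset.single_le_sum
      (f := fun k => (pder k (pder j (fun y => g y i)) x) ^ 2)
      (fun _ _ => by positivity) (Finset.mem_univ k)
  have bG : ∀ i j x, (pder j (fun y => g y i) x) ^ 2 ≤ grad2 g x := by
    intro i j x
    unfold grad2
    refine le_trans ?_ (Finset.single_le_sum (fun _ _ => by positivity) (Finset.mem_univ i))
    exact Finset.single_le_sum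
      (f := fun j => (pder j (fun y => g y i) x) ^ 2)
      (fun _ _ => by positivity) (Finset.mem_univ j)
  have main : ∀ i j k, ∫ x, |pder k (pder j (fun y => g y i)) x| ^ 3 ≤
      δ * (∫ x, third2 g x) + δ⁻¹ * ∫ x, grad2 g x * hess2 g x := by
    intro i j k
    refine (scalar_bound k _ (c1 i j) (s1 i j) δ hδ).trans ?_
    rw [← integral_const_mul, ← integral_const_mul,
      ← integral_add (iT.const_mul _) (iGH.const_mul _)]
    refine integral_mono_of_nonneg (Filter.Eventually.of_forall fun x => ?_)
      ((iT.const_mul _).add (iGH.const_mul _)) (Filter.Eventually.of_forall fun x => ?_)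
    · simp only [Pi.zero_apply]
      positivity
    · simp only
      have h1 := bT i j k x
      have h2 := mul_le_mul (bG i j x) (bH i j k x) (by positivity)
        ((sq_nonneg _).trans (bG i j x))
      gcongr
  have step : ∫ x, Real.sqrt (hess2 g x) ^ 3 ≤
      ∫ x, 729 * ∑ i, ∑ j, ∑ k, |pder k (pder j (fun y => g y i)) x| ^ 3 := by
    refine integral_mono_of_nonneg (Filter.Eventually.of_forall fun x => ?_) ?_
      (Filter.Eventually.of_forall fun x => ?_)
    · simp only [Pi.zero_apply]
      positivity
    · exact (integrable_finsetSum _ fun i _ => integrable_finsetSum _ fun j _ =>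
        integrable_finsetSum _ fun k _ => i3 i j k).const_mul _
    · exact sqrt_cube_le (fun i j k => pder k (pder j (fun y => g y i)) x)
  refine step.trans ?_
  rw [integral_const_mul, integral_finsetSum _ (fun i _ => integrable_finsetSum _ fun j _ =>
        integrable_finsetSum _ fun k _ => i3 i j k)]
  have hsum : ∑ i, ∫ x, ∑ j, ∑ k, |pder k (pder j (fun y => g y i)) x| ^ 3 ≤
      ∑ _i : Fin 3, ∑ _j : Fin 3, ∑ _k : Fin 3,
      (δ * (∫ x, third2 g x) + δ⁻¹ * ∫ x, grad2 g x * hess2 g x) := by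
    refine Finset.sum_le_sum fun i _ => ?_
    rw [integral_finsetSum _ (fun j _ => integrable_finsetSum _ fun k _ => i3 i j k)]
    refine Finset.sum_le_sum fun j _ => ?_
    rw [integral_finsetSum _ (fun k _ => i3 i j k)]
    exact Finset.sum_le_sum fun k _ => main i j k
  have hη' : η = 19683 * δ := by rw [hδd]; ring
  simp only [Finset.sum_const, Finset.card_univ, Fintype.card_fin, nsmul_eq_mul] at hsum
  rw [hη']
  push_cast at hsum
  linarith

end
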